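/- Suppose p is an escape model and let k > 0. Then α_p(k) < 1 if and only if d(k) > 1. -/

import Mathlib

open MeasureTheory Set Filter Topology
open scoped ENNReal NNReal

/-- The space `S = {I,II} × [0,∞) × ℕ`; `true` stands for Player I,
`false` for Player II. -/
abbrev GameS : Type := Bool × ℝ≥0 × ℕ

/-- `pk p i k n = p({ι = i} ∩ {γ ≥ k} ∩ {ξ = n})`. -/
noncomputable def pk (p : Measure GameS) (i : Bool) (k : ℝ≥0) (n : ℕ) : ℝ :=
  (p {s : GameS | s.1 = i ∧ k ≤ s.2.1 ∧ s.2.2 = n}).toReal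

/-- The generating function `G_i(k,x) = Σ_n p_i(k,n) xⁿ`. -/
noncomputable def Gk (p : Measure GameS) (i : Bool) (k : ℝ≥0) (x : ℝ) : ℝ :=
  ∑' n : ℕ, pk p i k n * x ^ n

/-- The value generating function
`f(k,x) = 1 − G_I(k,0) − G_I(k,1) + G_I(k,x) − G_II(k,1−x)`. -/
noncomputable def vgf (p : Measure GameS) (k : ℝ≥0) (x : ℝ) : ℝ :=
  1 - Gk p true k 0 - Gk p true k 1 + Gk p true k x - Gk p false k (1 - x)


/-- `α_p(k)`: the smallest fixed point of `f_k` in `[0,1]`. -/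
noncomputable def alphaP (p : Measure GameS) (k : ℝ≥0) : ℝ :=
  sInf {x ∈ Set.Icc (0:ℝ) 1 | vgf p k x = x}

/-- `d(k) = E_p[1_{ι = I, γ ≥ k}·ξ] + p({ι = II} ∩ {γ ≥ k} ∩ {ξ = 1}) ∈ [0,∞]`. -/
noncomputable def dk (p : Measure GameS) (k : ℝ≥0) : ℝ≥0∞ :=
  (∫⁻ s in {s : GameS | s.1 = true ∧ k ≤ s.2.1}, (s.2.2 : ℝ≥0∞) ∂p)
    + p {s : GameS | s.1 = false ∧ k ≤ s.2.1 ∧ s.2.2 = 1}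

theorem one_sub_pow_le_quadratic {x : ℝ} (hx0 : 0 ≤ x) (n : ℕ) :
    1 - x ^ n ≤ n * ((1 - x) - (1 - x) ^ 2) + (1 - x) ^ 2 := by
  rcases n with _ | n
  · simp only [pow_zero, sub_self, CharP.cast_eq_zero, zero_mul, zero_add]
    positivity
  · induction n with
    | zero => norm_num
    | succ n ih =>
      have h := mul_le_mul_of_nonneg_left ih hx0
      have h2 : (0 : ℝ) ≤ n * ((1 - x) ^ 2 * x) := by positivity
      have h3 : 0 ≤ (1 - x) ^ 2 * x := by positivity
      rw [pow_succ x (n + 1)]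
      push_cast at h ⊢
      nlinarith

theorem mul_pow_mul_le_one_sub_pow {x : ℝ} (hx0 : 0 ≤ x) (hx1 : x ≤ 1) {n N : ℕ} (hn : n ≤ N) :
    n * x ^ N * (1 - x) ≤ 1 - x ^ n := by
  rw [← geom_sum_mul_neg]
  refine mul_le_mul_of_nonneg_right ?_ (sub_nonneg.2 hx1)
  have h := Finset.card_nsmul_le_sum (Finset.range n) (fun i => x ^ i) (x ^ N) fun i hi =>
    pow_le_pow_of_le_one hx0 hx1 ((Finset.mem_range.1 hi).le.trans hn)
  simpa using h

theorem summable_mul_pow {a : ℕ → ℝ} (ha : ∀ n, 0 ≤ a n) (hs : Summable a) {x : ℝ}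
    (hx0 : 0 ≤ x) (hx1 : x ≤ 1) : Summable fun n => a n * x ^ n :=
  hs.of_nonneg_of_le (fun n => mul_nonneg (ha n) (pow_nonneg hx0 n))
    fun n => mul_le_of_le_one_right (ha n) (pow_le_one₀ hx0 hx1)

theorem continuousOn_tsum_mul_pow {a : ℕ → ℝ} (ha : ∀ n, 0 ≤ a n) (hs : Summable a) :
    ContinuousOn (fun x : ℝ => ∑' n, a n * x ^ n) (Icc 0 1) := by
  refine continuousOn_tsum (fun n => by fun_prop) hs fun n x hx => ?_
  rw [Real.norm_of_nonneg (mul_nonneg (ha n) (pow_nonneg hx.1 n))]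
  exact mul_le_of_le_one_right (ha n) (pow_le_one₀ hx.1 hx.2)

theorem lt_generatingFunction_of_slope_le_one {a b : ℕ → ℝ} (ha : ∀ n, 0 ≤ a n)
    (hb : ∀ n, 0 ≤ b n) (hsa : Summable a) (hsb : Summable b) (hb0 : b 0 = 0)
    (hlt : ∑' n, a n + ∑' n, b n < 1) (hd : Summable fun n : ℕ => n * a n)
    (hd1 : ∑' n : ℕ, n * a n + b 1 ≤ 1) {x : ℝ} (hx0 : 0 ≤ x) (hx1 : x < 1) :
    x < 1 - ∑' n, a n + ∑' n, a n * x ^ n - ∑' n, b n * (1 - x) ^ n := by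
  have hxa := summable_mul_pow ha hsa hx0 hx1.le
  have hxb := summable_mul_pow hb hsb (sub_nonneg.2 hx1.le) (by linarith : 1 - x ≤ 1)
  set y := 1 - x with hy
  have hA : ∑' n, a n - ∑' n, a n * x ^ n
      ≤ (∑' n : ℕ, n * a n) * (y - y ^ 2) + (∑' n, a n) * y ^ 2 := by
    refine hasSum_le (fun n => ?_) (hsa.hasSum.sub hxa.hasSum)
      ((hd.hasSum.mul_right _).add (hsa.hasSum.mul_right _))
    nlinarith [mul_le_mul_of_nonneg_left (one_sub_pow_le_quadratic hx0 n) (ha n)]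
  have hB : ∑' n, b n * y ^ n ≤ b 1 * (y - y ^ 2) + (∑' n, b n) * y ^ 2 := by
    refine hasSum_le (fun n => ?_) hxb.hasSum
      ((hasSum_ite_eq 1 (b 1 * (y - y ^ 2))).add (hsb.hasSum.mul_right _))
    rcases n with _ | _ | n
    · simp [hb0]
    · simp only [zero_add, if_true]; linarith
    · simp only [Nat.add_eq_right, Nat.add_eq_zero_iff, one_ne_zero, and_false,
        if_false, zero_add]
      exact mul_le_mul_of_nonneg_left
        (pow_le_pow_of_le_one (by linarith) (by linarith) (by omega)) (hb _)
  have h1 : 0 ≤ (1 - (∑' n : ℕ, n * a n + b 1)) * (y * x) :=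
    mul_nonneg (by linarith) (mul_nonneg (by linarith) hx0)
  have h2 : 0 < (1 - (∑' n, a n + ∑' n, b n)) * y ^ 2 :=
    mul_pos (by linarith) (pow_pos (by linarith) 2)
  have h3 : x = 1 - y := by linarith
  rw [h3] at h1
  nlinarith

theorem exists_generatingFunction_lt_of_one_lt_slope {a b : ℕ → ℝ} (ha : ∀ n, 0 ≤ a n)
    (hb : ∀ n, 0 ≤ b n) (hsa : Summable a) (hsb : Summable b) {N : ℕ}
    (hN : 1 < ∑ n ∈ Finset.range N, n * a n + b 1) :
    ∃ x ∈ Ioo (0 : ℝ) 1,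
      1 - ∑' n, a n + ∑' n, a n * x ^ n - ∑' n, b n * (1 - x) ^ n < x := by
  have hc : Tendsto (fun x : ℝ => (∑ n ∈ Finset.range N, n * a n) * x ^ N + b 1) (𝓝[<] 1)
      (𝓝 ((∑ n ∈ Finset.range N, n * a n) * 1 ^ N + b 1)) :=
    ((by fun_prop : Continuous fun x : ℝ =>
      (∑ n ∈ Finset.range N, n * a n) * x ^ N + b 1).tendsto 1).mono_left nhdsWithin_le_nhds
  rw [one_pow, mul_one] at hc
  obtain ⟨x, hx, hx0, hx1⟩ := ((hc.eventually (lt_mem_nhds hN)).and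
    (Ioo_mem_nhdsLT (zero_lt_one' ℝ))).exists
  refine ⟨x, ⟨hx0, hx1⟩, ?_⟩
  have hxa := summable_mul_pow ha hsa hx0.le hx1.le
  have hxb := summable_mul_pow hb hsb (sub_nonneg.2 hx1.le) (by linarith : 1 - x ≤ 1)
  have hA : (∑ n ∈ Finset.range N, n * a n) * x ^ N * (1 - x)
      ≤ ∑' n, a n - ∑' n, a n * x ^ n := by
    rw [← hsa.tsum_sub hxa, Finset.sum_mul, Finset.sum_mul]
    refine le_trans (Finset.sum_le_sum fun n hn => ?_)
      ((hsa.sub hxa).sum_le_tsum (Finset.range N) fun n _ =>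
        sub_nonneg.2 (mul_le_of_le_one_right (ha n) (pow_le_one₀ hx0.le hx1.le)))
    nlinarith [mul_le_mul_of_nonneg_left
      (mul_pow_mul_le_one_sub_pow hx0.le hx1.le (Finset.mem_range.1 hn).le) (ha n)]
  have hB : b 1 * (1 - x) ≤ ∑' n, b n * (1 - x) ^ n := by
    simpa using hxb.le_tsum 1 fun n _ => mul_nonneg (hb n) (pow_nonneg (by linarith) n)
  nlinarith [mul_lt_mul_of_pos_right hx (sub_pos.2 hx1)]

theorem hasSum_pk (p : Measure GameS) [IsProbabilityMeasure p] (i : Bool) (k : ℝ≥0) :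
    HasSum (pk p i k) (p.real {s : GameS | s.1 = i ∧ k ≤ s.2.1}) := by
  have hU : {s : GameS | s.1 = i ∧ k ≤ s.2.1}
      = ⋃ n : ℕ, {s : GameS | s.1 = i ∧ k ≤ s.2.1 ∧ s.2.2 = n} := by
    ext s; simp
  have h : p {s : GameS | s.1 = i ∧ k ≤ s.2.1}
      = ∑' n : ℕ, p {s : GameS | s.1 = i ∧ k ≤ s.2.1 ∧ s.2.2 = n} := by
    rw [hU]
    refine measure_iUnion (fun m n hmn => ?_) fun n => by measurability
    exact Set.disjoint_left.2 fun s hm hn => hmn (hm.2.2.symm.trans hn.2.2)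
  rw [Measure.real, h, ENNReal.tsum_toReal_eq fun n => measure_ne_top p _]
  exact (ENNReal.summable_toReal (h ▸ measure_ne_top p _)).hasSum

theorem dk_eq_tsum (p : Measure GameS) [IsProbabilityMeasure p] (k : ℝ≥0) :
    dk p k = ∑' n : ℕ, ENNReal.ofReal (n * pk p true k n) + ENNReal.ofReal (pk p false k 1) := by
  have hm : Measurable fun s : GameS => s.2.2 := by fun_prop
  have h := lintegral_map (μ := p.restrict {s : GameS | s.1 = true ∧ k ≤ s.2.1})
    (f := fun n : ℕ => (n : ℝ≥0∞)) (measurable_from_top) hm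
  rw [dk, ← h, lintegral_countable']
  congr 1
  · refine tsum_congr fun n => ?_
    rw [Measure.map_apply hm (measurableSet_singleton n),
      Measure.restrict_apply (hm (measurableSet_singleton n)),
      ENNReal.ofReal_mul n.cast_nonneg, ENNReal.ofReal_natCast, pk,
      ENNReal.ofReal_toReal (measure_ne_top p _)]
    congr 2
    ext s
    simp only [mem_inter_iff, mem_preimage, mem_singleton_iff, mem_ofPred_eq]
    tauto
  · rw [pk, ENNReal.ofReal_toReal (measure_ne_top p _)]

theorem pk_nonneg (p : Measure GameS) (i : Bool) (k : ℝ≥0) (n : ℕ) : 0 ≤ pk p i k n :=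
  ENNReal.toReal_nonneg

theorem pk_zero_of_escape {p : Measure GameS}
    (hesc : p {s : GameS | 0 < s.2.1 ∧ s.2.2 = 0} = 0) (i : Bool) {k : ℝ≥0} (hk : 0 < k) :
    pk p i k 0 = 0 := by
  have hsub : {s : GameS | s.1 = i ∧ k ≤ s.2.1 ∧ s.2.2 = 0} ⊆ {s : GameS | 0 < s.2.1 ∧ s.2.2 = 0} :=
    fun s hs => ⟨hk.trans_le hs.2.1, hs.2.2⟩
  rw [pk, measure_mono_null hsub hesc, ENNReal.toReal_zero]

theorem tsum_pk_add_tsum_pk_lt_one (p : Measure GameS) [IsProbabilityMeasure p] {k : ℝ≥0}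
    (hpos : 0 < p {s : GameS | s.2.1 < k}) :
    ∑' n, pk p true k n + ∑' n, pk p false k n < 1 := by
  have hm (i : Bool) : MeasurableSet {s : GameS | s.1 = i ∧ k ≤ s.2.1} := by measurability
  have hlt : MeasurableSet {s : GameS | s.2.1 < k} := by measurability
  have hU : {s : GameS | s.1 = true ∧ k ≤ s.2.1} ∪ {s : GameS | s.1 = false ∧ k ≤ s.2.1}
      = {s : GameS | s.2.1 < k}ᶜ := by
    ext ⟨i, c, n⟩
    cases i <;> simp
  rw [(hasSum_pk p true k).tsum_eq, (hasSum_pk p false k).tsum_eq,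
    ← measureReal_union (Set.disjoint_left.2 fun s h h' => by simp_all) (hm false), hU,
    probReal_compl_eq_one_sub hlt]
  have : 0 < p.real {s : GameS | s.2.1 < k} := ENNReal.toReal_pos hpos.ne' (measure_ne_top p _)
  linarith

theorem tsum_mul_zero_pow (a : ℕ → ℝ) : ∑' n, a n * (0 : ℝ) ^ n = a 0 := by
  rw [tsum_eq_single 0 fun n hn => by simp [hn]]
  simp

theorem vgf_eq_of_escape {p : Measure GameS}
    (hesc : p {s : GameS | 0 < s.2.1 ∧ s.2.2 = 0} = 0) {k : ℝ≥0} (hk : 0 < k) (x : ℝ) :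
    vgf p k x = 1 - ∑' n, pk p true k n + ∑' n, pk p true k n * x ^ n
      - ∑' n, pk p false k n * (1 - x) ^ n := by
  simp only [vgf, Gk, tsum_mul_zero_pow, pk_zero_of_escape hesc true hk, one_pow, mul_one, sub_zero]

/-- if `p` is an escape model (childless nodes have zero capacity, and
`p({γ < k}) > 0` for all `k > 0`), then for `k > 0` one has `α_p(k) < 1 ↔ d(k) > 1`. -/
theorem alphaP_lt_one_iff_dk_gt_one
    (p : Measure GameS) [IsProbabilityMeasure p]
    (hesc1 : p {s : GameS | 0 < s.2.1 ∧ s.2.2 = 0} = 0)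
    (hesc2 : ∀ k : ℝ≥0, 0 < k → 0 < p {s : GameS | s.2.1 < k})
    (k : ℝ≥0) (hk : 0 < k) :
    alphaP p k < 1 ↔ 1 < dk p k := by
  have ha := pk_nonneg p true k
  have hb := pk_nonneg p false k
  have hsa := (hasSum_pk p true k).summable
  have hsb := (hasSum_pk p false k).summable
  have ha0 := pk_zero_of_escape hesc1 true hk
  have hb0 := pk_zero_of_escape hesc1 false hk
  have hlt := tsum_pk_add_tsum_pk_lt_one p (hesc2 k hk)
  have hv := vgf_eq_of_escape hesc1 hk
  constructor
  · contrapose!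
    intro hd
    rw [dk_eq_tsum] at hd
    have hnonneg (n : ℕ) : 0 ≤ n * pk p true k n := mul_nonneg n.cast_nonneg (ha n)
    have hsum : Summable fun n : ℕ => n * pk p true k n := by
      have := ENNReal.summable_toReal
        (ne_top_of_le_ne_top ENNReal.one_ne_top (le_self_add.trans hd))
      simpa only [ENNReal.toReal_ofReal (hnonneg _)] using this
    rw [← ENNReal.ofReal_tsum_of_nonneg hnonneg hsum,
      ← ENNReal.ofReal_add (tsum_nonneg hnonneg) (hb 1), ENNReal.ofReal_le_one] at hd
    refine le_csInf ⟨1, ⟨zero_le_one, le_rfl⟩, ?_⟩ fun x ⟨hx, hfix⟩ => ?_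
    · rw [hv, sub_self, tsum_mul_zero_pow, hb0]
      simp
    · by_contra! hx1
      have := lt_generatingFunction_of_slope_le_one ha hb hsa hsb hb0 hlt hsum hd hx.1 hx1
      rw [← hv, hfix] at this
      exact this.false
  · intro hd
    rw [dk_eq_tsum] at hd
    obtain ⟨N, hN⟩ := (((ENNReal.tendsto_nat_tsum fun n : ℕ =>
      ENNReal.ofReal (n * pk p true k n)).add_const
        (ENNReal.ofReal (pk p false k 1))).eventually (lt_mem_nhds hd)).exists
    have hnonneg (n : ℕ) : 0 ≤ n * pk p true k n := mul_nonneg n.cast_nonneg (ha n)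
    rw [← ENNReal.ofReal_sum_of_nonneg fun n _ => hnonneg n,
      ← ENNReal.ofReal_add (Finset.sum_nonneg fun n _ => hnonneg n) (hb 1),
      ENNReal.one_lt_ofReal] at hN
    obtain ⟨x, ⟨hx0, hx1⟩, hx⟩ := exists_generatingFunction_lt_of_one_lt_slope ha hb hsa hsb hN
    rw [← hv] at hx
    have hcont : ContinuousOn (fun t => vgf p k t) (Icc 0 x) := by
      simp only [hv]
      refine (ContinuousOn.add continuousOn_const ((continuousOn_tsum_mul_pow ha hsa).mono
        (Icc_subset_Icc_right hx1.le))).sub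
          ((continuousOn_tsum_mul_pow hb hsb).comp (by fun_prop) fun t ht => ?_)
      exact ⟨by linarith [ht.2], by linarith [ht.1]⟩
    have h0 : 0 ≤ vgf p k 0 - 0 := by
      simp only [hv, tsum_mul_zero_pow, ha0, sub_zero, one_pow, mul_one]
      linarith
    obtain ⟨c, hc, hfix⟩ := intermediate_value_Icc' hx0.le (hcont.sub continuousOn_id)
      ⟨(sub_neg.2 hx).le, h0⟩
    have hmem : c ∈ {t ∈ Set.Icc (0 : ℝ) 1 | vgf p k t = t} :=
      ⟨⟨hc.1, hc.2.trans hx1.le⟩, sub_eq_zero.1 hfix⟩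
    exact (csInf_le ⟨0, fun t ht => ht.1.1⟩ hmem).trans_lt (hc.2.trans_lt hx1)
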